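/- For every even integer d ≥ 4, the caterpillar C(2,0,…,0,2) with spine on d − 1 vertices (so of diameter d) has edge-reconstruction number equal to 3. -/

import Mathlib

open SimpleGraph

namespace ErnPaper

/-- The weight of a vertex `v` in a graph `G`: the number of vertices in a largest
connected component of `G - v`. -/
noncomputable def wt {V : Type} [Fintype V] (G : SimpleGraph V) (v : V) : ℕ :=
  sSup {n | ∃ c : (G.induce ({v}ᶜ : Set V)).ConnectedComponent, n = Nat.card c.supp}

/-- The centroid of a graph: the set of vertices of minimum weight. -/
def centroid {V : Type} [Fintype V] (G : SimpleGraph V) : Set V :=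
  {v | ∀ u, wt G v ≤ wt G u}

/-- The edge-reconstruction number of a finite graph `G`: the least `k` for which there exist
`k` distinct edges `e₁, …, e_k` of `G` such that any finite graph `H` having `k` distinct
edges `f₁, …, f_k` with `H - fᵢ ≅ G - eᵢ` for all `i` must be isomorphic to `G`. -/
noncomputable def ern {V : Type} [Fintype V] (G : SimpleGraph V) : ℕ :=
  sInf {k | ∃ s : Finset (Sym2 V), s.card = k ∧ (↑s : Set (Sym2 V)) ⊆ G.edgeSet ∧
    ∀ (W : Type) (_ : Fintype W) (H : SimpleGraph W) (t : Finset (Sym2 W)),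
      (↑t : Set (Sym2 W)) ⊆ H.edgeSet →
      (∃ φ : {e // e ∈ s} ≃ {f // f ∈ t},
        ∀ e : {e // e ∈ s},
          Nonempty (H.deleteEdges {(φ e).1} ≃g G.deleteEdges {e.1})) →
      Nonempty (H ≃g G)}

/-- The spider tree `S_{p,q,r}`: three paths with `p`, `q`, `r` edges respectively,
emanating from a common central vertex. -/
def spider (p q r : ℕ) : SimpleGraph (Unit ⊕ (Fin p ⊕ Fin q ⊕ Fin r)) :=
  SimpleGraph.fromRel fun x y =>
    match x, y with
    | Sum.inl _, Sum.inr (Sum.inl j) => (j : ℕ) = 0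
    | Sum.inl _, Sum.inr (Sum.inr (Sum.inl j)) => (j : ℕ) = 0
    | Sum.inl _, Sum.inr (Sum.inr (Sum.inr j)) => (j : ℕ) = 0
    | Sum.inr (Sum.inl i), Sum.inr (Sum.inl j) => (j : ℕ) = (i : ℕ) + 1
    | Sum.inr (Sum.inr (Sum.inl i)), Sum.inr (Sum.inr (Sum.inl j)) => (j : ℕ) = (i : ℕ) + 1
    | Sum.inr (Sum.inr (Sum.inr i)), Sum.inr (Sum.inr (Sum.inr j)) => (j : ℕ) = (i : ℕ) + 1
    | _, _ => False

/-- A pseudopath: a tree isomorphic to a path `P_k`, to `S_{1,1,2}`, or to `S_{1,2,3}`. -/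
def IsPseudopath {V : Type} (T : SimpleGraph V) : Prop :=
  (∃ k, Nonempty (T ≃g pathGraph k)) ∨
    Nonempty (T ≃g spider 1 1 2) ∨ Nonempty (T ≃g spider 1 2 3)

/-- `T - xv + yv`: delete the end-edge `xv` and add the new edge `yv`. -/
def replaceEdge {V : Type} (T : SimpleGraph V) (x v y : V) : SimpleGraph V :=
  SimpleGraph.fromEdgeSet ((T.edgeSet \ {s(x, v)}) ∪ {s(y, v)})

/-- The disjoint union of two simple graphs. -/
def disjUnion {α β : Type} (G : SimpleGraph α) (H : SimpleGraph β) :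
    SimpleGraph (α ⊕ β) :=
  SimpleGraph.fromRel fun x y =>
    match x, y with
    | Sum.inl a, Sum.inl b => G.Adj a b
    | Sum.inr a, Sum.inr b => H.Adj a b
    | _, _ => False

/-- The caterpillar `C(2,0,…,0,2)` with spine on `m` vertices: spine path `v₀ … v_{m-1}`,
with two extra endvertices adjacent to `v₀` and two to `v_{m-1}`. -/
def doubleBroom (m : ℕ) : SimpleGraph (Fin m ⊕ Fin 4) :=
  SimpleGraph.fromRel fun x y =>
    match x, y with
    | Sum.inl i, Sum.inl j => (j : ℕ) = (i : ℕ) + 1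
    | Sum.inl i, Sum.inr l =>
        ((i : ℕ) = 0 ∧ (l : ℕ) < 2) ∨ ((i : ℕ) = m - 1 ∧ 2 ≤ (l : ℕ))
    | _, _ => False


/-! ### Reformulation of the reconstruction property -/

/-- The set `s` of edges determines `G` (form with an injective map). -/
def Good {V : Type} (G : SimpleGraph V) (s : Finset (Sym2 V)) : Prop :=
  ∀ (W : Type) (_ : Fintype W) (H : SimpleGraph W) (g : {e // e ∈ s} → Sym2 W),
    Function.Injective g → (∀ e, g e ∈ H.edgeSet) →
    (∀ e, Nonempty (H.deleteEdges {g e} ≃g G.deleteEdges {e.1})) → Nonempty (H ≃g G)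

theorem good_iff {V : Type} (G : SimpleGraph V) (s : Finset (Sym2 V)) :
    Good G s ↔ ∀ (W : Type) (_ : Fintype W) (H : SimpleGraph W) (t : Finset (Sym2 W)),
      (↑t : Set (Sym2 W)) ⊆ H.edgeSet →
      (∃ φ : {e // e ∈ s} ≃ {f // f ∈ t},
        ∀ e : {e // e ∈ s},
          Nonempty (H.deleteEdges {(φ e).1} ≃g G.deleteEdges {e.1})) →
      Nonempty (H ≃g G) := by
  classical
  constructor
  · rintro h W iW H t ht ⟨φ, hφ⟩
    refine h W iW H (fun e => (φ e).1) ?_ ?_ hφ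
    · intro a b hab
      exact φ.injective (Subtype.ext hab)
    · intro e
      exact ht (φ e).2
  · intro h W iW H g hg hge hiso
    refine h W iW H (Finset.univ.image g) ?_ ⟨Equiv.ofBijective
      (fun e => ⟨g e, Finset.mem_image_of_mem g (Finset.mem_univ e)⟩) ⟨?_, ?_⟩, ?_⟩
    · intro f hf
      simp only [Finset.coe_image, Set.mem_image] at hf
      obtain ⟨e, -, rfl⟩ := hf
      exact hge e
    · intro a b hab
      exact hg (congrArg Subtype.val hab)
    · rintro ⟨f, hf⟩
      obtain ⟨e, -, rfl⟩ := Finset.mem_image.1 hf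
      exact ⟨e, rfl⟩
    · intro e
      exact hiso e

theorem ern_eq {V : Type} [Fintype V] (G : SimpleGraph V) :
    ern G = sInf {k | ∃ s : Finset (Sym2 V), s.card = k ∧
      (↑s : Set (Sym2 V)) ⊆ G.edgeSet ∧ Good G s} := by
  unfold ern
  congr 1
  ext k
  simp only [Set.mem_ofPred_eq, good_iff]

/-- Isomorphisms restrict to cards. -/
def isoDel {V W : Type} {G : SimpleGraph V} {G' : SimpleGraph W} (ψ : G ≃g G') (e : Sym2 V) :
    G.deleteEdges {e} ≃g G'.deleteEdges {Sym2.map ψ e} where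
  toEquiv := ψ.toEquiv
  map_rel_iff' := by
    intro a b
    simp only [deleteEdges_adj, Set.mem_singleton_iff]
    have h1 : G'.Adj (ψ.toEquiv a) (ψ.toEquiv b) ↔ G.Adj a b := ψ.map_rel_iff'
    have h2 : s(ψ.toEquiv a, ψ.toEquiv b) = Sym2.map ψ s(a, b) := rfl
    rw [h1, h2, (Sym2.map.injective ψ.injective).eq_iff]

theorem good_transport {V W : Type} {G : SimpleGraph V} {G' : SimpleGraph W} (ψ : G ≃g G')
    (s : Finset (Sym2 V)) (hs : (↑s : Set (Sym2 V)) ⊆ G.edgeSet) (h : Good G s) :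
    ∃ s' : Finset (Sym2 W), s'.card = s.card ∧ (↑s' : Set (Sym2 W)) ⊆ G'.edgeSet ∧
      Good G' s' := by
  have hinj : Function.Injective (Sym2.map ψ) := Sym2.map.injective ψ.injective
  refine ⟨s.map ⟨Sym2.map ψ, hinj⟩, Finset.card_map _, ?_, ?_⟩
  · intro f hf
    simp only [Finset.coe_map, Function.Embedding.coeFn_mk, Set.mem_image] at hf
    obtain ⟨e, he, rfl⟩ := hf
    have := hs he
    induction e using Sym2.ind with
    | _ a b => exact ψ.map_rel_iff'.2 this
  · intro U iU H g hg hge hiso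
    obtain ⟨χ⟩ := h U iU H (fun e => g ⟨Sym2.map ψ e.1, Finset.mem_map.2 ⟨e.1, e.2, rfl⟩⟩)
      (by
        intro a b hab
        have := congrArg Subtype.val (hg hab)
        exact Subtype.ext (hinj this))
      (fun e => hge _)
      (by
        intro e
        obtain ⟨χ⟩ := hiso ⟨Sym2.map ψ e.1, Finset.mem_map.2 ⟨e.1, e.2, rfl⟩⟩
        exact ⟨χ.trans (isoDel ψ e.1).symm⟩)
    exact ⟨χ.trans ψ⟩

theorem ern_congr {V W : Type} [Fintype V] [Fintype W] {G : SimpleGraph V} {G' : SimpleGraph W}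
    (ψ : G ≃g G') : ern G = ern G' := by
  rw [ern_eq, ern_eq]
  congr 1
  ext k
  constructor
  · rintro ⟨s, rfl, h1, h2⟩
    exact good_transport ψ s h1 h2
  · rintro ⟨s, rfl, h1, h2⟩
    exact good_transport ψ.symm s h1 h2

/-- Two edge-cards which do not determine `G`. -/
def Bad {V : Type} (G : SimpleGraph V) (e e' : Sym2 V) : Prop :=
  ∃ (H : SimpleGraph V) (f f' : Sym2 V), f ≠ f' ∧ f ∈ H.edgeSet ∧ f' ∈ H.edgeSet ∧
    Nonempty (H.deleteEdges {f} ≃g G.deleteEdges {e}) ∧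
    Nonempty (H.deleteEdges {f'} ≃g G.deleteEdges {e'}) ∧ ¬ Nonempty (H ≃g G)

theorem Bad.symm {V : Type} {G : SimpleGraph V} {e e' : Sym2 V} (h : Bad G e e') :
    Bad G e' e := by
  obtain ⟨H, f, f', h1, h2, h3, h4, h5, h6⟩ := h
  exact ⟨H, f', f, h1.symm, h3, h2, h5, h4, h6⟩

theorem Bad.congr {V : Type} {G : SimpleGraph V} {e e' e₁ e₁' : Sym2 V} (h : Bad G e e')
    (h1 : Nonempty (G.deleteEdges {e} ≃g G.deleteEdges {e₁}))
    (h1' : Nonempty (G.deleteEdges {e'} ≃g G.deleteEdges {e₁'})) : Bad G e₁ e₁' := by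
  obtain ⟨H, f, f', h2, h3, h4, ⟨h5⟩, ⟨h6⟩, h7⟩ := h
  obtain ⟨h1⟩ := h1
  obtain ⟨h1'⟩ := h1'
  exact ⟨H, f, f', h2, h3, h4, ⟨h5.trans h1⟩, ⟨h6.trans h1'⟩, h7⟩

theorem not_good_of_bad {V : Type} [Fintype V] (G : SimpleGraph V) (e₀ : Sym2 V)
    (he₀ : e₀ ∈ G.edgeSet)
    (hbad : ∀ e ∈ G.edgeSet, ∀ e' ∈ G.edgeSet, Bad G e e') (s : Finset (Sym2 V))
    (hs : (↑s : Set (Sym2 V)) ⊆ G.edgeSet) (hc : s.card ≤ 2) : ¬ Good G s := by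
  classical
  have key : ∃ e ∈ G.edgeSet, ∃ e' ∈ G.edgeSet, ∀ u ∈ s, u = e ∨ u = e' := by
    have : s.card = 0 ∨ s.card = 1 ∨ s.card = 2 := by omega
    rcases this with h | h | h
    · rw [Finset.card_eq_zero] at h
      subst h
      exact ⟨e₀, he₀, e₀, he₀, by simp⟩
    · obtain ⟨e, rfl⟩ := Finset.card_eq_one.1 h
      exact ⟨e, hs (by simp), e, hs (by simp), by simp⟩
    · obtain ⟨e, e', -, rfl⟩ := Finset.card_eq_two.1 h
      exact ⟨e, hs (by simp), e', hs (by simp), by simp⟩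
  obtain ⟨e, he, e', he', hse⟩ := key
  obtain ⟨H, f, f', h1, h2, h3, h4, h5, h6⟩ := hbad e he e' he'
  intro hg
  refine h6 (hg V inferInstance H (fun u => if u.1 = e then f else f') ?_ ?_ ?_)
  · rintro ⟨u, hu⟩ ⟨v, hv⟩ huv
    have a := hse u hu
    have b := hse v hv
    simp only at huv
    split_ifs at huv with p q q <;> grind
  · intro u
    split_ifs <;> assumption
  · rintro ⟨u, hu⟩
    by_cases p : u = e
    · simp only [p, if_true]; exact h4
    · have : u = e' := (hse u hu).resolve_left p
      simp only [p, if_false]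
      rw [this]; exact h5

/-- To show that a set of edges is good, we may assume that the first card is literally equal. -/
theorem good_of {V : Type} [Fintype V] (G : SimpleGraph V) (e₁ e₂ e₃ : Sym2 V)
    (h12 : e₁ ≠ e₂) (h13 : e₁ ≠ e₃) (h23 : e₂ ≠ e₃) (s : Finset (Sym2 V))
    (h1 : e₁ ∈ s) (h2 : e₂ ∈ s) (h3 : e₃ ∈ s)
    (h : ∀ (H : SimpleGraph V) (y z : V) (f₂ f₃ : Sym2 V), y ≠ z → f₂ ≠ s(y, z) → f₃ ≠ s(y, z) →
      f₂ ≠ f₃ → f₂ ∈ H.edgeSet → f₃ ∈ H.edgeSet →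
      (∀ a b, H.Adj a b ↔ (G.deleteEdges {e₁}).Adj a b ∨ s(a, b) = s(y, z)) →
      Nonempty (H.deleteEdges {f₂} ≃g G.deleteEdges {e₂}) →
      Nonempty (H.deleteEdges {f₃} ≃g G.deleteEdges {e₃}) → Nonempty (H ≃g G)) :
    Good G s := by
  intro W iW H g hg hge hiso
  obtain ⟨ψ⟩ := hiso ⟨e₁, h1⟩
  obtain ⟨χ₂⟩ := hiso ⟨e₂, h2⟩
  obtain ⟨χ₃⟩ := hiso ⟨e₃, h3⟩
  have n12 : g ⟨e₂, h2⟩ ≠ g ⟨e₁, h1⟩ := fun hh => h12 (congrArg Subtype.val (hg hh)).symm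
  have n13 : g ⟨e₃, h3⟩ ≠ g ⟨e₁, h1⟩ := fun hh => h13 (congrArg Subtype.val (hg hh)).symm
  have n23 : g ⟨e₂, h2⟩ ≠ g ⟨e₃, h3⟩ := fun hh => h23 (congrArg Subtype.val (hg hh))
  have m1 := hge ⟨e₁, h1⟩
  have m2 := hge ⟨e₂, h2⟩
  have m3 := hge ⟨e₃, h3⟩
  generalize g ⟨e₁, h1⟩ = f₁ at *
  generalize g ⟨e₂, h2⟩ = f₂ at *
  generalize g ⟨e₃, h3⟩ = f₃ at *
  let H' : SimpleGraph V := H.comap ψ.symm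
  let θ : H ≃g H' := ⟨ψ.toEquiv, by
    intro a b
    change H.Adj (ψ.symm (ψ a)) (ψ.symm (ψ b)) ↔ _
    simp⟩
  have hinj : Function.Injective (Sym2.map θ) := Sym2.map.injective θ.injective
  induction f₁ using Sym2.ind with
  | _ y z =>
    have hyz : H.Adj y z := m1
    obtain ⟨ρ⟩ := h H' (θ y) (θ z) (Sym2.map θ f₂) (Sym2.map θ f₃)
      (fun hh => hyz.ne (θ.injective hh))
      (fun hh => n12 (hinj hh))
      (fun hh => n13 (hinj hh))
      (fun hh => n23 (hinj hh))
      (by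
        induction f₂ using Sym2.ind with
        | _ a b => exact θ.map_rel_iff'.2 m2)
      (by
        induction f₃ using Sym2.ind with
        | _ a b => exact θ.map_rel_iff'.2 m3)
      (by
        intro a b
        obtain ⟨a, rfl⟩ := ψ.surjective a
        obtain ⟨b, rfl⟩ := ψ.surjective b
        have e1 : (G.deleteEdges {e₁}).Adj (ψ a) (ψ b) ↔ (H.deleteEdges {s(y, z)}).Adj a b :=
          ψ.map_rel_iff'
        have e2 : H'.Adj (ψ a) (ψ b) ↔ H.Adj a b := θ.map_rel_iff'
        have e3 : s(ψ a, ψ b) = s(θ y, θ z) ↔ s(a, b) = s(y, z) :=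
          ⟨fun hh => hinj hh, fun hh => congrArg (Sym2.map θ) hh⟩
        rw [e1, e2, e3, deleteEdges_adj, Set.mem_singleton_iff]
        constructor
        · intro hh
          by_cases hc : s(a, b) = s(y, z)
          · exact Or.inr hc
          · exact Or.inl ⟨hh, hc⟩
        · rintro (hh | hh)
          · exact hh.1
          · have : s(a, b) ∈ H.edgeSet := hh ▸ m1
            exact this)
      ⟨(isoDel θ f₂).symm.trans χ₂⟩ ⟨(isoDel θ f₃).symm.trans χ₃⟩
    exact ⟨θ.trans ρ⟩

/-! ### Concrete graphs on `Fin n` -/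

/-- The graph on `Fin n` given by a relation on the natural numbers. -/
def mk (n : ℕ) (R : ℕ → ℕ → Prop) : SimpleGraph (Fin n) where
  Adj a b := a.1 ≠ b.1 ∧ (R a.1 b.1 ∨ R b.1 a.1)
  symm := ⟨fun _ _ h => ⟨h.1.symm, h.2.symm⟩⟩
  loopless := ⟨fun _ h => h.1 rfl⟩

theorem mk_adj {n : ℕ} {R : ℕ → ℕ → Prop} {a b : Fin n} :
    (mk n R).Adj a b ↔ a.1 ≠ b.1 ∧ (R a.1 b.1 ∨ R b.1 a.1) := Iff.rfl

/-- Relation of the double broom: path `0, …, m+1`, further leaves `m+2` at `1`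
and `m+3` at `m`. -/
def R (m a b : ℕ) : Prop :=
  (b = a + 1 ∧ b ≤ m + 1) ∨ (a = 1 ∧ b = m + 2) ∨ (a = m ∧ b = m + 3)

/-- The double broom on `Fin (m+4)`. -/
def GG (m : ℕ) : SimpleGraph (Fin (m + 4)) := mk (m + 4) (R m)

theorem del_adj {n : ℕ} {Q : ℕ → ℕ → Prop} {a b p q : Fin n} :
    ((mk n Q).deleteEdges {s(p, q)}).Adj a b ↔ (a.1 ≠ b.1 ∧ (Q a.1 b.1 ∨ Q b.1 a.1)) ∧
      ¬ ((a.1 = p.1 ∧ b.1 = q.1) ∨ (a.1 = q.1 ∧ b.1 = p.1)) := by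
  simp only [deleteEdges_adj, mk_adj, Set.mem_singleton_iff, Sym2.eq_iff, Fin.ext_iff]

/-- Isomorphism given by an involution of the natural numbers. -/
theorem isoOf {n : ℕ} {A B : SimpleGraph (Fin n)} (f : ℕ → ℕ) (hlt : ∀ a, a < n → f a < n)
    (hinv : ∀ a, a < n → f (f a) = a)
    (h : ∀ a b : Fin n, A.Adj a b → B.Adj ⟨f a, hlt a a.2⟩ ⟨f b, hlt b b.2⟩)
    (h' : ∀ a b : Fin n, B.Adj a b → A.Adj ⟨f a, hlt a a.2⟩ ⟨f b, hlt b b.2⟩) :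
    Nonempty (A ≃g B) := by
  refine ⟨⟨⟨fun a => ⟨f a, hlt a a.2⟩, fun a => ⟨f a, hlt a a.2⟩, ?_, ?_⟩, ?_⟩⟩
  · intro a; exact Fin.ext (hinv a a.2)
  · intro a; exact Fin.ext (hinv a a.2)
  · intro a b
    constructor
    · intro hh
      have := h' _ _ hh
      have ea : (⟨f (f a), hlt _ (hlt a a.2)⟩ : Fin n) = a := Fin.ext (hinv a a.2)
      have eb : (⟨f (f b), hlt _ (hlt b b.2)⟩ : Fin n) = b := Fin.ext (hinv b b.2)
      simpa [ea, eb] using this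
    · exact h a b

theorem exists_iso_GG (m : ℕ) (hm : 3 ≤ m) : Nonempty (doubleBroom m ≃g GG m) := by
  let F : Fin m ⊕ Fin 4 → Fin (m + 4) := fun x => match x with
    | Sum.inl i => ⟨i.1 + 1, by omega⟩
    | Sum.inr l => if l.1 = 0 then ⟨0, by omega⟩ else if l.1 = 1 then ⟨m + 2, by omega⟩
        else if l.1 = 2 then ⟨m + 1, by omega⟩ else ⟨m + 3, by omega⟩
  have hF : Function.Injective F := by
    rintro (i | l) (j | k) h
    · simp only [F, Fin.mk.injEq] at h
      congr 1; ext; omega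
    · exfalso
      have := i.2
      simp only [F] at h
      split_ifs at h <;> simp only [Fin.mk.injEq] at h <;> omega
    · exfalso
      have := j.2
      simp only [F] at h
      split_ifs at h <;> simp only [Fin.mk.injEq] at h <;> omega
    · have := l.2
      have := k.2
      simp only [F] at h
      congr 1; ext
      split_ifs at h <;> simp only [Fin.mk.injEq] at h <;> omega
  have hb : Function.Bijective F := by
    rw [Fintype.bijective_iff_injective_and_card]
    exact ⟨hF, by simp⟩
  refine ⟨⟨Equiv.ofBijective F hb, ?_⟩⟩
  rintro (i | l) (j | k)
  · have := i.2
    have := j.2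
    simp only [Equiv.ofBijective_apply, GG, mk_adj, F, R, doubleBroom, fromRel_adj, ne_eq,
      Sum.inl.injEq, Fin.ext_iff]
    omega
  · have := i.2
    have := k.2
    simp only [Equiv.ofBijective_apply, GG, mk_adj, F, R, doubleBroom, fromRel_adj, ne_eq,
      reduceCtorEq, not_false_eq_true, true_and, or_false]
    split_ifs <;> (try simp only [false_and, and_false, or_false, false_or, not_false_eq_true,
      true_and, and_true]) <;> omega
  · have := l.2
    have := j.2
    simp only [Equiv.ofBijective_apply, GG, mk_adj, F, R, doubleBroom, fromRel_adj, ne_eq,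
      reduceCtorEq, not_false_eq_true, true_and, false_or]
    split_ifs <;> (try simp only [false_and, and_false, or_false, false_or, not_false_eq_true,
      true_and, and_true]) <;> omega
  · have := l.2
    have := k.2
    simp only [Equiv.ofBijective_apply, GG, mk_adj, F, R, doubleBroom, fromRel_adj, ne_eq,
      Sum.inr.injEq, or_false, and_false, iff_false]
    split_ifs <;> (try simp only [false_and, and_false, or_false, false_or, not_false_eq_true,
      true_and, and_true]) <;> omega

/-! ### Pairs of cards never suffice -/

/-- The edge `ab`. -/
def ed (n a b : ℕ) (ha : a < n) (hb : b < n) : Sym2 (Fin n) := s(⟨a, ha⟩, ⟨b, hb⟩)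

theorem edges_GG (m : ℕ) (hm : 3 ≤ m) (e : Sym2 (Fin (m + 4))) (he : e ∈ (GG m).edgeSet) :
    e = ed (m + 4) 0 1 (by omega) (by omega) ∨
    e = ed (m + 4) 1 (m + 2) (by omega) (by omega) ∨
    e = ed (m + 4) m (m + 1) (by omega) (by omega) ∨
    e = ed (m + 4) m (m + 3) (by omega) (by omega) ∨
    ∃ i, ∃ h : 1 ≤ i ∧ i < m, e = ed (m + 4) i (i + 1) (by omega) (by omega) := by
  have key : ∀ a b : Fin (m + 4), R m a.1 b.1 → s(a, b) = ed (m + 4) 0 1 (by omega) (by omega) ∨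
      s(a, b) = ed (m + 4) 1 (m + 2) (by omega) (by omega) ∨
      s(a, b) = ed (m + 4) m (m + 1) (by omega) (by omega) ∨
      s(a, b) = ed (m + 4) m (m + 3) (by omega) (by omega) ∨
      ∃ i, ∃ h : 1 ≤ i ∧ i < m, s(a, b) = ed (m + 4) i (i + 1) (by omega) (by omega) := by
    rintro ⟨a, ha⟩ ⟨b, hb⟩ h
    simp only [R] at h
    rcases h with h | h | h
    · obtain ⟨rfl, h⟩ := h
      by_cases h0 : a = 0
      · subst h0; left; rfl
      · by_cases h1 : a = m
        · subst h1; right; right; left; rfl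
        · right; right; right; right
          exact ⟨a, by omega, rfl⟩
    · obtain ⟨rfl, rfl⟩ := h
      right; left; rfl
    · obtain ⟨rfl, rfl⟩ := h
      right; right; right; left; rfl
  induction e using Sym2.ind with
  | _ a b =>
    rcases (show _ ∧ _ from he).2 with h | h
    · exact key a b h
    · rw [Sym2.eq_swap]; exact key b a h

/-- Overall reversal. -/
def rev (m t : ℕ) : ℕ := if t ≤ m + 1 then m + 1 - t else if t = m + 2 then m + 3 else m + 2

/-- Swap of two numbers. -/
def sw (p q t : ℕ) : ℕ := if t = p then q else if t = q then p else t

/-- Reflection of an interval. -/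
def rfl' (p q t : ℕ) : ℕ := if p ≤ t ∧ t ≤ q then p + q - t else t

/-- Relation of `G - ab + cd`. -/
def RX (m a b c d : ℕ) (u v : ℕ) : Prop := (R m u v ∧ ¬ (u = a ∧ v = b)) ∨ (u = c ∧ v = d)

/-- Isomorphism of cards given by an involution of the natural numbers. -/
theorem isoDelOf {n : ℕ} {A B : ℕ → ℕ → Prop} {p q p' q' : ℕ} {hp : p < n} {hq : q < n}
    {hp' : p' < n} {hq' : q' < n} (f : ℕ → ℕ) (hlt : ∀ a, a < n → f a < n)
    (hinv : ∀ a, a < n → f (f a) = a)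
    (h : ∀ a b, a < n → b < n → A a b → ((a = p ∧ b = q) ∨ (a = q ∧ b = p)) ∨
      ((B (f a) (f b) ∨ B (f b) (f a)) ∧
        ¬ ((f a = p' ∧ f b = q') ∨ (f a = q' ∧ f b = p'))))
    (h' : ∀ a b, a < n → b < n → B a b → ((a = p' ∧ b = q') ∨ (a = q' ∧ b = p')) ∨
      ((A (f a) (f b) ∨ A (f b) (f a)) ∧
        ¬ ((f a = p ∧ f b = q) ∨ (f a = q ∧ f b = p)))) :
    Nonempty ((mk n A).deleteEdges {ed n p q hp hq} ≃g
      (mk n B).deleteEdges {ed n p' q' hp' hq'}) := by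
  have inj : ∀ a b, a < n → b < n → f a = f b → a = b := by
    intro a b ha hb hab
    rw [← hinv a ha, hab, hinv b hb]
  refine isoOf f hlt hinv ?_ ?_
  · rintro ⟨a, ha⟩ ⟨b, hb⟩ hab
    simp only [ed, del_adj] at hab ⊢
    have h1 := h a b ha hb
    have h2 := h b a hb ha
    refine ⟨⟨fun hh => hab.1.1 (inj a b ha hb hh), ?_⟩, ?_⟩ <;> grind
  · rintro ⟨a, ha⟩ ⟨b, hb⟩ hab
    simp only [ed, del_adj] at hab ⊢
    have h1 := h' a b ha hb
    have h2 := h' b a hb ha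
    refine ⟨⟨fun hh => hab.1.1 (inj a b ha hb hh), ?_⟩, ?_⟩ <;> grind

theorem card_rev (m i : ℕ) (hm : 3 ≤ m) (h1 : 1 ≤ i) (h2 : i < m) :
    Nonempty ((GG m).deleteEdges {ed (m + 4) i (i + 1) (by omega) (by omega)} ≃g
      (GG m).deleteEdges {ed (m + 4) (m - i) (m - i + 1) (by omega) (by omega)}) := by
  refine isoDelOf (rev m) ?_ ?_ ?_ ?_
  · intro a ha; unfold rev; grind
  · intro a ha; unfold rev; grind
  · intro a b ha hb h
    simp only [R, rev] at *
    grind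
  · intro a b ha hb h
    simp only [R, rev] at *
    grind

theorem card_P1 (m : ℕ) (hm : 3 ≤ m) :
    Nonempty ((GG m).deleteEdges {ed (m + 4) 1 (m + 2) (by omega) (by omega)} ≃g
      (GG m).deleteEdges {ed (m + 4) 0 1 (by omega) (by omega)}) := by
  refine isoDelOf (sw 0 (m + 2)) ?_ ?_ ?_ ?_
  · intro a ha; unfold sw; grind
  · intro a ha; unfold sw; grind
  · intro a b ha hb h
    simp only [R, sw] at *
    grind
  · intro a b ha hb h
    simp only [R, sw] at *
    grind

theorem card_P2 (m : ℕ) (hm : 3 ≤ m) :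
    Nonempty ((GG m).deleteEdges {ed (m + 4) 1 (m + 2) (by omega) (by omega)} ≃g
      (GG m).deleteEdges {ed (m + 4) m (m + 3) (by omega) (by omega)}) := by
  refine isoDelOf (rev m) ?_ ?_ ?_ ?_
  · intro a ha; unfold rev; grind
  · intro a ha; unfold rev; grind
  · intro a b ha hb h
    simp only [R, rev] at *
    grind
  · intro a b ha hb h
    simp only [R, rev] at *
    grind

theorem card_P3 (m : ℕ) (hm : 3 ≤ m) :
    Nonempty ((GG m).deleteEdges {ed (m + 4) m (m + 3) (by omega) (by omega)} ≃g
      (GG m).deleteEdges {ed (m + 4) m (m + 1) (by omega) (by omega)}) := by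
  refine isoDelOf (sw (m + 1) (m + 3)) ?_ ?_ ?_ ?_
  · intro a ha; unfold sw; grind
  · intro a ha; unfold sw; grind
  · intro a b ha hb h
    simp only [R, sw] at *
    grind
  · intro a b ha hb h
    simp only [R, sw] at *
    grind

theorem ed_ne {n a b c d : ℕ} {ha : a < n} {hb : b < n} {hc : c < n} {hd : d < n}
    (h : ¬ ((a = c ∧ b = d) ∨ (a = d ∧ b = c))) : ed n a b ha hb ≠ ed n c d hc hd := by
  simpa only [ed, ne_eq, Sym2.eq_iff, Fin.mk.injEq] using h

theorem ed_mem {n a b : ℕ} {Q : ℕ → ℕ → Prop} {ha : a < n} {hb : b < n}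
    (h : a ≠ b ∧ (Q a b ∨ Q b a)) : ed n a b ha hb ∈ (mk n Q).edgeSet := h

/-- Common construction: `H = G - ab + cd`, with a second edge `pq` of `H`. -/
theorem bad_of (m a b c d p q p' q' : ℕ) (ha : a < m + 4) (hb : b < m + 4) (hc : c < m + 4)
    (hd : d < m + 4) (hp : p < m + 4) (hq : q < m + 4) (hp' : p' < m + 4) (hq' : q' < m + 4)
    (hab : a < b) (hcd : c ≠ d)
    (hncd : ¬ R m c d) (hndc : ¬ R m d c)
    (hne : ¬ ((c = p ∧ d = q) ∨ (c = q ∧ d = p)))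
    (hpq : p ≠ q ∧ (RX m a b c d p q ∨ RX m a b c d q p))
    (hiso : Nonempty ((mk (m + 4) (RX m a b c d)).deleteEdges {ed (m + 4) p q hp hq} ≃g
      (GG m).deleteEdges {ed (m + 4) p' q' hp' hq'}))
    (hno : ¬ Nonempty (mk (m + 4) (RX m a b c d) ≃g GG m)) (hm : 3 ≤ m) :
    Bad (GG m) (ed (m + 4) a b ha hb) (ed (m + 4) p' q' hp' hq') := by
  refine ⟨mk (m + 4) (RX m a b c d), ed (m + 4) c d hc hd, ed (m + 4) p q hp hq, ed_ne hne,
    ed_mem ⟨hcd, Or.inl (Or.inr ⟨rfl, rfl⟩)⟩, ed_mem hpq, ?_, hiso, hno⟩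
  have : (mk (m + 4) (RX m a b c d)).deleteEdges {ed (m + 4) c d hc hd} =
      (GG m).deleteEdges {ed (m + 4) a b ha hb} := by
    ext ⟨u, hu⟩ ⟨v, hv⟩
    simp only [GG, ed, del_adj, RX]
    constructor
    · rintro ⟨⟨h1, h2⟩, h3⟩
      have h4 : ¬ (R m b a) := by simp only [R]; omega
      refine ⟨⟨h1, by grind⟩, by grind⟩
    · rintro ⟨⟨h1, h2⟩, h3⟩
      refine ⟨⟨h1, by grind⟩, by grind⟩
  rw [this]
  exact ⟨Iso.refl⟩

/-- In `G` the neighbour of a leaf has degree at least three. -/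
theorem no_iso_A {m : ℕ} (hm : 3 ≤ m) {H : SimpleGraph (Fin (m + 4))} (u w p q : Fin (m + 4))
    (h1 : H.Adj u w) (h2 : ∀ t, H.Adj u t → t = w) (h3 : ∀ t, H.Adj w t → t = p ∨ t = q) :
    ¬ Nonempty (H ≃g GG m) := by
  rintro ⟨φ⟩
  have g1 : (GG m).Adj (φ u) (φ w) := φ.map_rel_iff'.2 h1
  have g2 : ∀ t, (GG m).Adj (φ u) t → t = φ w := by
    intro t ht
    obtain ⟨t, rfl⟩ := φ.surjective t
    rw [h2 t (φ.map_rel_iff'.1 ht)]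
  have g3 : ∀ t, (GG m).Adj (φ w) t → t = φ p ∨ t = φ q := by
    intro t ht
    obtain ⟨t, rfl⟩ := φ.surjective t
    rcases h3 t (φ.map_rel_iff'.1 ht) with h | h
    · left; rw [h]
    · right; rw [h]
  generalize φ u = u at *
  generalize φ w = w at *
  generalize φ p = p at *
  generalize φ q = q at *
  clear φ h1 h2 h3
  obtain ⟨u, hu⟩ := u
  obtain ⟨w, hw⟩ := w
  obtain ⟨p, hp⟩ := p
  obtain ⟨q, hq⟩ := q
  have g2' : ∀ t, t < m + 4 → (u ≠ t ∧ (R m u t ∨ R m t u)) → t = w := by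
    intro t ht h
    exact congrArg Fin.val (g2 ⟨t, ht⟩ h)
  have g3' : ∀ t, t < m + 4 → (w ≠ t ∧ (R m w t ∨ R m t w)) → t = p ∨ t = q := by
    intro t ht h
    rcases g3 ⟨t, ht⟩ h with h | h
    · left; exact congrArg Fin.val h
    · right; exact congrArg Fin.val h
  simp only [GG, mk_adj, R] at g1
  simp only [R] at g2' g3'
  have hw' : w = 1 ∨ w = m := by
    have a1 := g2' (u + 1)
    have a2 := g2' (u - 1)
    grind
  clear g2' g2 g3 g1
  rcases hw' with e | e
  · have a1 := g3' 0 (by omega) (by omega)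
    have a2 := g3' 2 (by omega) (by omega)
    have a3 := g3' (m + 2) (by omega) (by omega)
    omega
  · have a1 := g3' (m - 1) (by omega) (by omega)
    have a2 := g3' (m + 1) (by omega) (by omega)
    have a3 := g3' (m + 3) (by omega) (by omega)
    omega

/-- In `G` a vertex of degree three does not have two non-leaf neighbours. -/
theorem no_iso_B {m : ℕ} (hm : 3 ≤ m) {H : SimpleGraph (Fin (m + 4))}
    (w a b c a' b' : Fin (m + 4)) (h1 : H.Adj w a) (h2 : H.Adj w b) (h3 : H.Adj w c)
    (h4 : a ≠ b) (h5 : a ≠ c) (h6 : b ≠ c) (h7 : H.Adj a a') (h8 : H.Adj b b')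
    (h9 : a' ≠ w) (h10 : b' ≠ w) : ¬ Nonempty (H ≃g GG m) := by
  rintro ⟨φ⟩
  have g1 : (GG m).Adj (φ w) (φ a) := φ.map_rel_iff'.2 h1
  have g2 : (GG m).Adj (φ w) (φ b) := φ.map_rel_iff'.2 h2
  have g3 : (GG m).Adj (φ w) (φ c) := φ.map_rel_iff'.2 h3
  have g7 : (GG m).Adj (φ a) (φ a') := φ.map_rel_iff'.2 h7
  have g8 : (GG m).Adj (φ b) (φ b') := φ.map_rel_iff'.2 h8
  have g4 := φ.injective.ne h4
  have g5 := φ.injective.ne h5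
  have g6 := φ.injective.ne h6
  have g9 := φ.injective.ne h9
  have g10 := φ.injective.ne h10
  simp only [GG, mk_adj, R, ne_eq, Fin.ext_iff] at *
  clear h1 h2 h3 h4 h5 h6 h7 h8 h9 h10
  have e : (φ w).1 = 1 ∨ (φ w).1 = m := by clear g7 g8 g9 g10; omega
  rcases e with e | e
  · have ea : (φ a).1 = 2 := by clear g2 g3 g8; omega
    have eb : (φ b).1 = 2 := by clear g1 g3 g7; omega
    omega
  · have ea : (φ a).1 = m - 1 := by clear g2 g3 g8; omega
    have eb : (φ b).1 = m - 1 := by clear g1 g3 g7; omega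
    omega

/-- `G` has no vertex of degree four. -/
theorem no_iso_C {m : ℕ} (hm : 3 ≤ m) {H : SimpleGraph (Fin (m + 4))}
    (w a b c d : Fin (m + 4)) (h1 : H.Adj w a) (h2 : H.Adj w b) (h3 : H.Adj w c)
    (h4 : H.Adj w d) (n1 : a ≠ b) (n2 : a ≠ c) (n3 : a ≠ d) (n4 : b ≠ c) (n5 : b ≠ d)
    (n6 : c ≠ d) : ¬ Nonempty (H ≃g GG m) := by
  rintro ⟨φ⟩
  have g1 : (GG m).Adj (φ w) (φ a) := φ.map_rel_iff'.2 h1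
  have g2 : (GG m).Adj (φ w) (φ b) := φ.map_rel_iff'.2 h2
  have g3 : (GG m).Adj (φ w) (φ c) := φ.map_rel_iff'.2 h3
  have g4 : (GG m).Adj (φ w) (φ d) := φ.map_rel_iff'.2 h4
  have k1 := φ.injective.ne n1
  have k2 := φ.injective.ne n2
  have k3 := φ.injective.ne n3
  have k4 := φ.injective.ne n4
  have k5 := φ.injective.ne n5
  have k6 := φ.injective.ne n6
  simp only [GG, mk_adj, R, ne_eq, Fin.ext_iff] at *
  clear h1 h2 h3 h4 n1 n2 n3 n4 n5 n6
  grind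

/-- `G` has no triangle. -/
theorem no_iso_D {m : ℕ} (hm : 3 ≤ m) {H : SimpleGraph (Fin (m + 4))}
    (a b c : Fin (m + 4)) (h1 : H.Adj a b) (h2 : H.Adj b c) (h3 : H.Adj a c) :
    ¬ Nonempty (H ≃g GG m) := by
  rintro ⟨φ⟩
  have g1 : (GG m).Adj (φ a) (φ b) := φ.map_rel_iff'.2 h1
  have g2 : (GG m).Adj (φ b) (φ c) := φ.map_rel_iff'.2 h2
  have g3 : (GG m).Adj (φ a) (φ c) := φ.map_rel_iff'.2 h3
  simp only [GG, mk_adj, R, ne_eq] at *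
  clear h1 h2 h3
  omega

theorem bad_PP (m : ℕ) (hm : 3 ≤ m) :
    Bad (GG m) (ed (m + 4) 1 (m + 2) (by omega) (by omega))
      (ed (m + 4) 1 (m + 2) (by omega) (by omega)) := by
  apply bad_of m 1 (m + 2) m (m + 2) m (m + 3) 1 (m + 2) <;> try omega
  · simp only [R]; grind
  · simp only [R]; grind
  · simp only [RX, R]; grind
  · refine isoDelOf (sw (m + 2) (m + 3)) ?_ ?_ ?_ ?_
    · intro a ha; unfold sw; grind
    · intro a ha; unfold sw; grind
    · intro a b ha hb h
      simp only [R, RX, sw] at *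
      grind
    · intro a b ha hb h
      simp only [R, RX, sw] at *
      grind
  · apply no_iso_C hm ⟨m, by omega⟩ ⟨m - 1, by omega⟩ ⟨m + 1, by omega⟩ ⟨m + 2, by omega⟩
      ⟨m + 3, by omega⟩ <;> simp only [mk_adj, RX, R, ne_eq, Fin.mk.injEq] <;> grind

theorem bad_PQ (m i : ℕ) (hm : 3 ≤ m) (h1 : 1 ≤ i) (h2 : i < m) (hi : i ≠ 2) :
    Bad (GG m) (ed (m + 4) 1 (m + 2) (by omega) (by omega))
      (ed (m + 4) i (i + 1) (by omega) (by omega)) := by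
  apply bad_of m 1 (m + 2) (i - 1) (m + 2) i (i + 1) i (i + 1) <;> try omega
  · simp only [R]; grind
  · simp only [R]; grind
  · simp only [RX, R]; grind
  · refine isoDelOf (rfl' 0 i) ?_ ?_ ?_ ?_
    · intro a ha; unfold rfl'; grind
    · intro a ha; unfold rfl'; grind
    · intro a b ha hb h
      simp only [R, RX, rfl'] at *
      grind
    · intro a b ha hb h
      simp only [R, RX, rfl'] at *
      grind
  · by_cases h : i = 1
    · subst h
      apply no_iso_A hm ⟨m + 2, by omega⟩ ⟨0, by omega⟩ ⟨m + 2, by omega⟩ ⟨1, by omega⟩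
      · simp only [mk_adj, RX, R]; grind
      · rintro ⟨t, ht⟩; simp only [mk_adj, RX, R, Fin.mk.injEq]; grind
      · rintro ⟨t, ht⟩; simp only [mk_adj, RX, R, Fin.mk.injEq]; grind
    · apply no_iso_A hm ⟨0, by omega⟩ ⟨1, by omega⟩ ⟨0, by omega⟩ ⟨2, by omega⟩
      · simp only [mk_adj, RX, R]; grind
      · rintro ⟨t, ht⟩; simp only [mk_adj, RX, R, Fin.mk.injEq]; grind
      · rintro ⟨t, ht⟩; simp only [mk_adj, RX, R, Fin.mk.injEq]; grind

theorem bad_QQ (m p q : ℕ) (hm : 3 ≤ m) (h1 : 1 ≤ q) (h2 : q + 2 ≤ p) (h3 : p < m) :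
    Bad (GG m) (ed (m + 4) p (p + 1) (by omega) (by omega))
      (ed (m + 4) q (q + 1) (by omega) (by omega)) := by
  apply bad_of m p (p + 1) (q + 1) (p + 1) q (q + 1) q (q + 1) <;> try omega
  · simp only [R]; grind
  · simp only [R]; grind
  · simp only [RX, R]; grind
  · refine isoDelOf (rfl' (q + 1) p) ?_ ?_ ?_ ?_
    · intro a ha; unfold rfl'; grind
    · intro a ha; unfold rfl'; grind
    · intro a b ha hb h
      simp only [R, RX, rfl'] at *
      grind
    · intro a b ha hb h
      simp only [R, RX, rfl'] at *
      grind
  · apply no_iso_B hm ⟨q + 1, by omega⟩ ⟨q, by omega⟩ ⟨p + 1, by omega⟩ ⟨q + 2, by omega⟩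
      ⟨q - 1, by omega⟩ ⟨p + 2, by omega⟩ <;>
      simp only [mk_adj, RX, R, ne_eq, Fin.mk.injEq] <;> grind

/-- Reflection of the cycle `0, …, p` fixing `1`. -/
def cyc (p t : ℕ) : ℕ := if t ≤ 2 then 2 - t else if t ≤ p then p + 3 - t else t

theorem bad_cyc (m p : ℕ) (hm : 3 ≤ m) (h1 : 3 ≤ p) (h3 : p < m) :
    Bad (GG m) (ed (m + 4) p (p + 1) (by omega) (by omega))
      (ed (m + 4) p (p + 1) (by omega) (by omega)) := by
  apply bad_of m p (p + 1) 0 p 2 3 p (p + 1) <;> try omega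
  · simp only [R]; grind
  · simp only [R]; grind
  · simp only [RX, R]; grind
  · refine isoDelOf (cyc p) ?_ ?_ ?_ ?_
    · intro a ha; unfold cyc; grind
    · intro a ha; unfold cyc; grind
    · intro a b ha hb h
      simp only [R, RX, cyc] at *
      rcases h with ⟨h | h | h, h'⟩ | h <;> obtain ⟨e1, e2⟩ := h
      · by_cases c1 : a = 2
        · left; omega
        · right
          by_cases c2 : a ≤ 2 <;> by_cases c3 : a ≤ p <;> by_cases c4 : b ≤ 2 <;>
            by_cases c5 : b ≤ p <;> simp only [c2, c3, c4, c5, if_true, if_false] <;>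
            first | omega | grind
      · grind
      · grind
      · grind
    · intro a b ha hb h
      simp only [R, RX, cyc] at *
      rcases h with h | h | h <;> obtain ⟨e1, e2⟩ := h
      · by_cases c1 : a = p
        · left; omega
        · right
          by_cases c2 : a ≤ 2 <;> by_cases c3 : a ≤ p <;> by_cases c4 : b ≤ 2 <;>
            by_cases c5 : b ≤ p <;> simp only [c2, c3, c4, c5, if_true, if_false] <;>
            first | omega | grind
      · grind
      · grind
  · apply no_iso_B hm ⟨1, by omega⟩ ⟨0, by omega⟩ ⟨2, by omega⟩ ⟨m + 2, by omega⟩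
      ⟨p, by omega⟩ ⟨3, by omega⟩ <;>
      simp only [mk_adj, RX, R, ne_eq, Fin.mk.injEq] <;> grind

theorem bad_tri (m : ℕ) (hm : 3 ≤ m) :
    Bad (GG m) (ed (m + 4) 1 2 (by omega) (by omega))
      (ed (m + 4) 1 2 (by omega) (by omega)) := by
  apply bad_of m 1 2 0 (m + 2) 0 1 1 2 <;> try omega
  · simp only [R]; grind
  · simp only [R]; grind
  · simp only [RX, R]; grind
  · refine isoDelOf (sw 1 (m + 2)) ?_ ?_ ?_ ?_
    · intro a ha; unfold sw; grind
    · intro a ha; unfold sw; grind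
    · intro a b ha hb h
      simp only [R, RX, sw] at *
      grind
    · intro a b ha hb h
      simp only [R, RX, sw] at *
      grind
  · apply no_iso_D hm ⟨0, by omega⟩ ⟨1, by omega⟩ ⟨m + 2, by omega⟩ <;>
      simp only [mk_adj, RX, R] <;> grind

/-- Every edge is equivalent to a pendant edge or to a spine edge in the left half. -/
theorem edge_class (m : ℕ) (hm : 3 ≤ m) (hodd : m % 2 = 1) (e : Sym2 (Fin (m + 4)))
    (he : e ∈ (GG m).edgeSet) :
    Nonempty ((GG m).deleteEdges {ed (m + 4) 1 (m + 2) (by omega) (by omega)} ≃g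
      (GG m).deleteEdges {e}) ∨
    ∃ i, ∃ h : 1 ≤ i ∧ 2 * i < m,
      Nonempty ((GG m).deleteEdges {ed (m + 4) i (i + 1) (by omega) (by omega)} ≃g
      (GG m).deleteEdges {e}) ∧
      Nonempty ((GG m).deleteEdges {ed (m + 4) (m - i) (m - i + 1) (by omega) (by omega)} ≃g
      (GG m).deleteEdges {e}) := by
  rcases edges_GG m hm e he with rfl | rfl | rfl | rfl | ⟨i, hi, rfl⟩
  · left; exact card_P1 m hm
  · left; exact ⟨Iso.refl⟩
  · left
    obtain ⟨a⟩ := card_P2 m hm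
    obtain ⟨b⟩ := card_P3 m hm
    exact ⟨a.trans b⟩
  · left; exact card_P2 m hm
  · right
    obtain ⟨a⟩ := card_rev m i hm hi.1 hi.2
    by_cases h : 2 * i < m
    · exact ⟨i, by omega, ⟨Iso.refl⟩, ⟨a.symm⟩⟩
    · refine ⟨m - i, by omega, ⟨a.symm⟩, ?_⟩
      have : m - (m - i) = i := by omega
      simp only [this]
      exact ⟨Iso.refl⟩

theorem bad_all (m : ℕ) (hm : 3 ≤ m) (hodd : m % 2 = 1) (e : Sym2 (Fin (m + 4)))
    (he : e ∈ (GG m).edgeSet) (e' : Sym2 (Fin (m + 4))) (he' : e' ∈ (GG m).edgeSet) :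
    Bad (GG m) e e' := by
  have PQ : ∀ e e' : Sym2 (Fin (m + 4)),
      Nonempty ((GG m).deleteEdges {ed (m + 4) 1 (m + 2) (by omega) (by omega)} ≃g
      (GG m).deleteEdges {e}) → (∃ i, ∃ h : 1 ≤ i ∧ 2 * i < m,
      Nonempty ((GG m).deleteEdges {ed (m + 4) i (i + 1) (by omega) (by omega)} ≃g
      (GG m).deleteEdges {e'}) ∧
      Nonempty ((GG m).deleteEdges {ed (m + 4) (m - i) (m - i + 1) (by omega) (by omega)} ≃g
      (GG m).deleteEdges {e'})) → Bad (GG m) e e' := by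
    rintro e e' h ⟨i, hi, h1, h2⟩
    by_cases h3 : i = 2
    · exact (bad_PQ m (m - i) hm (by omega) (by omega) (by omega)).congr h h2
    · exact (bad_PQ m i hm (by omega) (by omega) (by omega)).congr h h1
  rcases edge_class m hm hodd e he with h | h
  · rcases edge_class m hm hodd e' he' with h' | h'
    · exact (bad_PP m hm).congr h h'
    · exact PQ e e' h h'
  · rcases edge_class m hm hodd e' he' with h' | h'
    · exact (PQ e' e h' h).symm
    · obtain ⟨i, hi, h1, h2⟩ := h
      obtain ⟨k, hk, k1, k2⟩ := h'
      by_cases h3 : i + k + 2 ≤ m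
      · exact (bad_QQ m (m - i) k hm (by omega) (by omega) (by omega)).congr h2 k1
      · have : k = i := by omega
        subst this
        by_cases h4 : k = 1
        · subst h4
          exact (bad_tri m hm).congr h1 k1
        · exact (bad_cyc m (m - k) hm (by omega) (by omega)).congr h2 k2

/-! ### Three suitable cards suffice -/

/-- `v` has at least three neighbours. -/
def D3 {V : Type} (K : SimpleGraph V) (v : V) : Prop :=
  ∃ a b c, a ≠ b ∧ a ≠ c ∧ b ≠ c ∧ K.Adj v a ∧ K.Adj v b ∧ K.Adj v c

theorem D3.map {V W : Type} {K : SimpleGraph V} {L : SimpleGraph W} (φ : K ≃g L) {v : V}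
    (h : D3 K v) : D3 L (φ v) := by
  obtain ⟨a, b, c, h1, h2, h3, h4, h5, h6⟩ := h
  exact ⟨φ a, φ b, φ c, φ.injective.ne h1, φ.injective.ne h2, φ.injective.ne h3,
    φ.map_rel_iff'.2 h4, φ.map_rel_iff'.2 h5, φ.map_rel_iff'.2 h6⟩

theorem D3.mono {V : Type} {K L : SimpleGraph V} (hKL : K ≤ L) {v : V} (h : D3 K v) :
    D3 L v := by
  obtain ⟨a, b, c, h1, h2, h3, h4, h5, h6⟩ := h
  exact ⟨a, b, c, h1, h2, h3, hKL h4, hKL h5, hKL h6⟩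

/-- The new graph attaches the vertex `m+2` to a vertex `y`. -/
theorem form_H (m : ℕ) (hm : 3 ≤ m) (j : ℕ) (hj1 : 1 ≤ j) (hj2 : j < m)
    (H : SimpleGraph (Fin (m + 4))) (y z : Fin (m + 4))
    (f : Sym2 (Fin (m + 4))) (hyz : y ≠ z)
    (hH : ∀ a b, H.Adj a b ↔
      ((GG m).deleteEdges {ed (m + 4) 1 (m + 2) (by omega) (by omega)}).Adj a b ∨
        s(a, b) = s(y, z))
    (hf : Nonempty (H.deleteEdges {f} ≃g
      (GG m).deleteEdges {ed (m + 4) j (j + 1) (by omega) (by omega)})) :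
    ∃ w : Fin (m + 4), w.1 ≠ m + 2 ∧ s(y, z) = ed (m + 4) w.1 (m + 2) w.2 (by omega) ∧
      H = mk (m + 4) (RX m 1 (m + 2) w.1 (m + 2)) := by
  have hx : ∃ t, H.Adj ⟨m + 2, by omega⟩ t := by
    obtain ⟨φ⟩ := hf
    have key : ∀ v : Fin (m + 4), ∃ t, ((GG m).deleteEdges
        {ed (m + 4) j (j + 1) (by omega) (by omega)}).Adj v t := by
      rintro ⟨v, hv⟩
      simp only [GG, ed, del_adj, R]
      by_cases h1 : v = m + 2
      · exact ⟨⟨1, by omega⟩, by grind⟩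
      by_cases h2 : v = m + 3
      · exact ⟨⟨m, by omega⟩, by grind⟩
      by_cases h3 : v ≤ j
      · by_cases h4 : v = 0
        · exact ⟨⟨1, by omega⟩, by grind⟩
        · exact ⟨⟨v - 1, by omega⟩, by grind⟩
      · by_cases h4 : v = m + 1
        · exact ⟨⟨m, by omega⟩, by grind⟩
        · exact ⟨⟨v + 1, by omega⟩, by grind⟩
    obtain ⟨t, ht⟩ := key (φ ⟨m + 2, by omega⟩)
    obtain ⟨t, rfl⟩ := φ.surjective t
    exact ⟨t, (H.deleteEdges_le {f}) (φ.map_rel_iff'.1 ht)⟩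
  have hxm : s(y, z) = s(⟨m + 2, by omega⟩, y) ∨ s(y, z) = s(⟨m + 2, by omega⟩, z) := by
    obtain ⟨t, ht⟩ := hx
    rw [hH] at ht
    rcases ht with ht | ht
    · exfalso
      simp only [GG, ed, del_adj, R] at ht
      grind
    · simp only [Sym2.eq_iff, Fin.ext_iff] at ht ⊢
      grind
  have main : ∀ w : Fin (m + 4), w.1 ≠ m + 2 → s(y, z) = ed (m + 4) w.1 (m + 2) w.2 (by omega) →
      H = mk (m + 4) (RX m 1 (m + 2) w.1 (m + 2)) := by
    rintro ⟨w, hw⟩ hne e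
    ext ⟨a, ha⟩ ⟨b, hb⟩
    rw [hH, e]
    simp only [GG, ed, del_adj, mk_adj, RX, R, Sym2.eq_iff, Fin.mk.injEq] at *
    grind
  rcases hxm with h | h
  · refine ⟨y, ?_, ?_, main y ?_ ?_⟩
    · simp only [Sym2.eq_iff, Fin.ext_iff, ne_eq] at h hyz ⊢; grind
    · rw [h, Sym2.eq_swap]; rfl
    · simp only [Sym2.eq_iff, Fin.ext_iff, ne_eq] at h hyz ⊢; grind
    · rw [h, Sym2.eq_swap]; rfl
  · refine ⟨z, ?_, ?_, main z ?_ ?_⟩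
    · simp only [Sym2.eq_iff, Fin.ext_iff, ne_eq] at h hyz ⊢; grind
    · rw [h, Sym2.eq_swap]; rfl
    · simp only [Sym2.eq_iff, Fin.ext_iff, ne_eq] at h hyz ⊢; grind
    · rw [h, Sym2.eq_swap]; rfl

theorem iso_one (m : ℕ) : Nonempty (mk (m + 4) (RX m 1 (m + 2) 1 (m + 2)) ≃g GG m) := by
  have : mk (m + 4) (RX m 1 (m + 2) 1 (m + 2)) = GG m := by
    ext ⟨a, ha⟩ ⟨b, hb⟩
    simp only [GG, mk_adj, RX, R]
    grind
  rw [this]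
  exact ⟨Iso.refl⟩

set_option maxHeartbeats 1000000 in
theorem D3_H (m y : ℕ) (hm : 5 ≤ m) (h1 : y ≠ 1) (h2 : y ≠ m + 2) (hy : y < m + 4)
    (v : Fin (m + 4)) (h : D3 (mk (m + 4) (RX m 1 (m + 2) y (m + 2))) v) :
    v.1 = m ∨ (v.1 = y ∧ 2 ≤ y ∧ y < m) := by
  obtain ⟨a, b, c, n1, n2, n3, g1, g2, g3⟩ := h
  simp only [mk_adj, RX, R, ne_eq, Fin.ext_iff] at *
  by_contra hc
  have hc1 : v.1 ≠ m := fun h => hc (Or.inl h)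
  have hv := v.2
  by_cases e : v.1 = y
  · have hc2 : y = 0 ∨ y = m + 1 ∨ y = m + 3 := by omega
    rcases hc2 with rfl | rfl | rfl
    · have e1 : a.1 = 1 ∨ a.1 = m + 2 := by clear g2 g3; omega
      have e2 : b.1 = 1 ∨ b.1 = m + 2 := by clear g1 g3; omega
      have e3 : c.1 = 1 ∨ c.1 = m + 2 := by clear g1 g2; omega
      clear g1 g2 g3; omega
    · have e1 : a.1 = m ∨ a.1 = m + 2 := by clear g2 g3; omega
      have e2 : b.1 = m ∨ b.1 = m + 2 := by clear g1 g3; omega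
      have e3 : c.1 = m ∨ c.1 = m + 2 := by clear g1 g2; omega
      clear g1 g2 g3; omega
    · have e1 : a.1 = m ∨ a.1 = m + 2 := by clear g2 g3; omega
      have e2 : b.1 = m ∨ b.1 = m + 2 := by clear g1 g3; omega
      have e3 : c.1 = m ∨ c.1 = m + 2 := by clear g1 g2; omega
      clear g1 g2 g3; omega
  · by_cases e' : v.1 = m + 2
    · clear g3 n2 n3; omega
    by_cases e'' : v.1 = m + 3
    · clear g3 n2 n3; omega
    have e1 : a.1 = v.1 + 1 ∨ a.1 + 1 = v.1 := by clear g2 g3; omega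
    have e2 : b.1 = v.1 + 1 ∨ b.1 + 1 = v.1 := by clear g1 g3; omega
    have e3 : c.1 = v.1 + 1 ∨ c.1 + 1 = v.1 := by clear g1 g2; omega
    clear g1 g2 g3; omega

/-- Isolated vertices and leaves of the card `G - e` for a pendant edge `e`. -/
theorem card_P_props (m : ℕ) (hm : 5 ≤ m) (K : SimpleGraph (Fin (m + 4)))
    (h : Nonempty (K ≃g (GG m).deleteEdges {ed (m + 4) 0 1 (by omega) (by omega)})) :
    (∃ o, ∀ t, ¬ K.Adj o t) ∧ (∀ u w, D3 K u → D3 K w → u = w) ∧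
    (∃ w a b, D3 K w ∧ a ≠ b ∧ K.Adj w a ∧ K.Adj w b ∧ (∀ t, K.Adj a t → t = w) ∧
      (∀ t, K.Adj b t → t = w)) := by
  obtain ⟨φ⟩ := h
  refine ⟨⟨φ.symm ⟨0, by omega⟩, ?_⟩, ?_, ?_⟩
  · intro t ht
    have := φ.map_rel_iff'.2 ht
    change ((GG m).deleteEdges {ed (m + 4) 0 1 (by omega) (by omega)}).Adj
      (φ (φ.symm ⟨0, by omega⟩)) (φ t) at this
    rw [φ.apply_symm_apply] at this
    simp only [GG, ed, del_adj, R] at this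
    grind
  · have key : ∀ v, D3 ((GG m).deleteEdges {ed (m + 4) 0 1 (by omega) (by omega)}) v →
        v.1 = m := by
      rintro v ⟨a, b, c, n1, n2, n3, g1, g2, g3⟩
      simp only [GG, ed, del_adj, R, ne_eq, Fin.ext_iff] at *
      by_contra hc
      have hv := v.2
      by_cases e : v.1 = 1
      · have e3 : c.1 = 2 ∨ c.1 = m + 2 := by clear g1 g2; omega
        clear g3
        have e1 : a.1 = 2 ∨ a.1 = m + 2 := by clear g2; omega
        have e2 : b.1 = 2 ∨ b.1 = m + 2 := by clear g1; omega
        clear g1 g2; omega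
      · have e1 : a.1 = v.1 + 1 ∨ a.1 + 1 = v.1 ∨ v.1 > m + 1 := by clear g2 g3; omega
        have e2 : b.1 = v.1 + 1 ∨ b.1 + 1 = v.1 ∨ v.1 > m + 1 := by clear g1 g3; omega
        have e3 : c.1 = v.1 + 1 ∨ c.1 + 1 = v.1 ∨ v.1 > m + 1 := by clear g1 g2; omega
        by_cases e' : v.1 > m + 1
        · clear g3 n2 n3 e1 e2 e3; omega
        · clear g1 g2 g3; omega
    intro u w hu hw
    apply φ.injective
    have h1 := key _ (hu.map φ)
    have h2 := key _ (hw.map φ)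
    exact Fin.ext (h1.trans h2.symm)
  · have hD : D3 ((GG m).deleteEdges {ed (m + 4) 0 1 (by omega) (by omega)}) ⟨m, by omega⟩ := by
      refine ⟨⟨m - 1, by omega⟩, ⟨m + 1, by omega⟩, ⟨m + 3, by omega⟩, ?_, ?_, ?_, ?_, ?_, ?_⟩ <;>
        simp only [GG, ed, del_adj, R, ne_eq, Fin.mk.injEq] <;> grind
    have back : ∀ a b, ((GG m).deleteEdges {ed (m + 4) 0 1 (by omega) (by omega)}).Adj a b ↔
        K.Adj (φ.symm a) (φ.symm b) := fun a b => φ.symm.map_rel_iff'.symm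
    refine ⟨φ.symm ⟨m, by omega⟩, φ.symm ⟨m + 1, by omega⟩, φ.symm ⟨m + 3, by omega⟩,
      hD.map φ.symm, φ.symm.injective.ne ?_, ?_, ?_, ?_, ?_⟩
    · simp
    · rw [← back]; simp only [GG, ed, del_adj, R]; grind
    · rw [← back]; simp only [GG, ed, del_adj, R]; grind
    · intro t ht
      obtain ⟨t, rfl⟩ := φ.symm.surjective t
      rw [← back] at ht
      congr 1
      simp only [GG, ed, del_adj, R, Fin.ext_iff] at *; grind
    · intro t ht
      obtain ⟨t, rfl⟩ := φ.symm.surjective t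
      rw [← back] at ht
      congr 1
      simp only [GG, ed, del_adj, R, Fin.ext_iff] at *; grind


/-- Endpoints of the second edge deleted. -/
theorem pend_edge (m y p q : ℕ) (hm : 5 ≤ m) (h2 : 2 ≤ y) (h3 : y < m)
    (o : ℕ) (ho : o < m + 4)
    (hne : ¬ ((p = y ∧ q = m + 2) ∨ (p = m + 2 ∧ q = y)))
    (hiso : ∀ t, t < m + 4 → (o ≠ t ∧ (RX m 1 (m + 2) y (m + 2) o t ∨
      RX m 1 (m + 2) y (m + 2) t o)) → (o = p ∧ t = q) ∨ (o = q ∧ t = p)) :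
    ((p = 0 ∧ q = 1) ∨ (p = 1 ∧ q = 0)) ∨ ((p = m ∧ q = m + 1) ∨ (p = m + 1 ∧ q = m)) ∨
      ((p = m ∧ q = m + 3) ∨ (p = m + 3 ∧ q = m)) := by
  by_cases h0 : o = 0
  · have := hiso 1 (by omega) (by simp only [RX, R]; grind)
    grind
  by_cases h4 : o = m + 1
  · have := hiso m (by omega) (by simp only [RX, R]; grind)
    grind
  by_cases h5 : o = m + 3
  · have := hiso m (by omega) (by simp only [RX, R]; grind)
    grind
  by_cases h6 : o = m + 2
  · have := hiso y (by omega) (by simp only [RX, R]; grind)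
    grind
  have a1 := hiso (o - 1) (by omega) (by simp only [RX, R]; grind)
  have a2 := hiso (o + 1) (by omega) (by simp only [RX, R]; grind)
  omega

theorem leaf_y (m y p q : ℕ) (hm : 5 ≤ m) (h2 : 2 ≤ y) (h3 : y < m)
    (hpq : ((p = m ∧ q = m + 1) ∨ (p = m + 1 ∧ q = m)) ∨
      ((p = m ∧ q = m + 3) ∨ (p = m + 3 ∧ q = m)))
    (a : ℕ) (ha : a < m + 4)
    (hya : y ≠ a ∧ (RX m 1 (m + 2) y (m + 2) y a ∨ RX m 1 (m + 2) y (m + 2) a y))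
    (hl : ∀ t, t < m + 4 → (a ≠ t ∧ (RX m 1 (m + 2) y (m + 2) a t ∨
      RX m 1 (m + 2) y (m + 2) t a)) ∧ ¬ ((a = p ∧ t = q) ∨ (a = q ∧ t = p)) → t = y) :
    a = m + 2 := by
  have h : a = m + 2 ∨ a = y + 1 ∨ a + 1 = y := by
    simp only [RX, R] at hya; omega
  rcases h with h | h | h
  · exact h
  · by_cases h4 : y + 1 = m
    · have b1 := hl (m + 1) (by omega)
      have b2 := hl (m + 3) (by omega)
      simp only [RX, R] at b1 b2
      grind
    · have := hl (y + 2) (by omega) (by simp only [RX, R]; grind)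
      omega
  · have := hl (y - 2) (by omega) (by simp only [RX, R]; grind)
    omega

theorem upper5_aux (m : ℕ) (hm : 5 ≤ m) (w p q : Fin (m + 4)) (h2 : 2 ≤ w.1) (h3 : w.1 < m)
    (hne : ¬ ((p.1 = w.1 ∧ q.1 = m + 2) ∨ (p.1 = m + 2 ∧ q.1 = w.1)))
    (h : Nonempty ((mk (m + 4) (RX m 1 (m + 2) w.1 (m + 2))).deleteEdges {s(p, q)} ≃g
      (GG m).deleteEdges {ed (m + 4) 0 1 (by omega) (by omega)})) : False := by
  obtain ⟨⟨o, ho⟩, hu, ⟨x, a, b, hx, hab, hxa, hxb, hla, hlb⟩⟩ := card_P_props m hm _ h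
  have hpq := pend_edge m w.1 p.1 q.1 hm h2 h3 o.1 o.2 hne (by
    intro t ht hh
    have := ho ⟨t, ht⟩
    simp only [del_adj] at this
    by_contra hc
    exact this ⟨hh, hc⟩)
  clear ho
  have hy : D3 ((mk (m + 4) (RX m 1 (m + 2) w.1 (m + 2))).deleteEdges {s(p, q)}) w := by
    refine ⟨⟨w.1 - 1, by omega⟩, ⟨w.1 + 1, by omega⟩, ⟨m + 2, by omega⟩, ?_, ?_, ?_, ?_, ?_, ?_⟩
    · simp only [ne_eq, Fin.mk.injEq]; omega
    · simp only [ne_eq, Fin.mk.injEq]; omega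
    · simp only [ne_eq, Fin.mk.injEq]; omega
    · simp only [del_adj, RX, R]; grind
    · simp only [del_adj, RX, R]; grind
    · simp only [del_adj, RX, R]; grind
  rcases hpq with hpq | hpq
  · have hmm : D3 ((mk (m + 4) (RX m 1 (m + 2) w.1 (m + 2))).deleteEdges {s(p, q)})
        ⟨m, by omega⟩ := by
      refine ⟨⟨m - 1, by omega⟩, ⟨m + 1, by omega⟩, ⟨m + 3, by omega⟩, ?_, ?_, ?_, ?_, ?_, ?_⟩
      · simp only [ne_eq, Fin.mk.injEq]; omega
      · simp only [ne_eq, Fin.mk.injEq]; omega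
      · simp only [ne_eq, Fin.mk.injEq]; omega
      · simp only [del_adj, RX, R]; grind
      · simp only [del_adj, RX, R]; grind
      · simp only [del_adj, RX, R]; grind
    have := congrArg Fin.val (hu _ _ hy hmm)
    simp only at this
    omega
  · have hxw := hu _ _ hx hy
    subst hxw
    simp only [del_adj] at hxa hxb hla hlb
    have e1 := leaf_y m x.1 p.1 q.1 hm h2 h3 hpq a.1 a.2 hxa.1
      (fun t ht hh => congrArg Fin.val (hla ⟨t, ht⟩ hh))
    have e2 := leaf_y m x.1 p.1 q.1 hm h2 h3 hpq b.1 b.2 hxb.1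
      (fun t ht hh => congrArg Fin.val (hlb ⟨t, ht⟩ hh))
    exact hab (Fin.ext (e1.trans e2.symm))

theorem upper5 (m : ℕ) (hm : 5 ≤ m) : Good (GG m)
    {ed (m + 4) 1 (m + 2) (by omega) (by omega), ed (m + 4) 0 1 (by omega) (by omega),
      ed (m + 4) 2 3 (by omega) (by omega)} := by
  refine good_of (GG m) (ed (m + 4) 1 (m + 2) (by omega) (by omega))
    (ed (m + 4) 0 1 (by omega) (by omega)) (ed (m + 4) 2 3 (by omega) (by omega))
    (ed_ne (by omega)) (ed_ne (by omega)) (ed_ne (by omega)) _ (by simp) (by simp) (by simp) ?_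
  intro H y z f₂ f₃ hyz hf2 hf3 hf23 hmem _ hH h2 h3
  obtain ⟨w, hw, hs, rfl⟩ := form_H m (by omega) 2 (by omega) (by omega) H y z f₃ hyz hH h3
  by_cases hw1 : w.1 = 1
  · rw [hw1]; exact iso_one m
  have hr : 2 ≤ w.1 ∧ w.1 < m := by
    obtain ⟨φ⟩ := h3
    have d1 : D3 ((GG m).deleteEdges {ed (m + 4) 2 3 (by omega) (by omega)}) ⟨1, by omega⟩ := by
      refine ⟨⟨0, by omega⟩, ⟨2, by omega⟩, ⟨m + 2, by omega⟩, ?_, ?_, ?_, ?_, ?_, ?_⟩ <;>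
        simp only [GG, ed, del_adj, R, ne_eq, Fin.mk.injEq] <;> grind
    have d2 : D3 ((GG m).deleteEdges {ed (m + 4) 2 3 (by omega) (by omega)}) ⟨m, by omega⟩ := by
      refine ⟨⟨m - 1, by omega⟩, ⟨m + 1, by omega⟩, ⟨m + 3, by omega⟩, ?_, ?_, ?_, ?_, ?_, ?_⟩ <;>
        simp only [GG, ed, del_adj, R, ne_eq, Fin.mk.injEq] <;> grind
    have c1 := D3_H m w.1 hm hw1 hw w.2 _ ((d1.map φ.symm).mono (deleteEdges_le _))
    have c2 := D3_H m w.1 hm hw1 hw w.2 _ ((d2.map φ.symm).mono (deleteEdges_le _))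
    have hne : φ.symm ⟨1, by omega⟩ ≠ φ.symm ⟨m, by omega⟩ := by
      apply φ.symm.injective.ne
      simp only [ne_eq, Fin.mk.injEq]; omega
    rw [ne_eq, Fin.ext_iff] at hne
    omega
  exfalso
  induction f₂ using Sym2.ind with
  | _ p q =>
  rw [hs] at hf2
  refine upper5_aux m hm w p q hr.1 hr.2 ?_ h2
  simpa only [ed, ne_eq, Sym2.eq_iff, Fin.ext_iff] using hf2

/-! ### The case of diameter four -/

instance (m a b : ℕ) : Decidable (R m a b) := by unfold R; infer_instance

instance (m a b c d u v : ℕ) : Decidable (RX m a b c d u v) := by unfold RX; infer_instance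

/-- Some vertex with exactly three neighbours has only leaves as neighbours. -/
def InvQ {V : Type} (A : V → V → Prop) : Prop :=
  ∃ v, (∀ t, A v t → ∀ u, A t u → u = v) ∧
    ∃ a, A v a ∧ ∃ b, A v b ∧ a ≠ b ∧ ∃ c, A v c ∧ a ≠ c ∧ b ≠ c ∧
      ∀ t, A v t → t = a ∨ t = b ∨ t = c

instance {n : ℕ} (A : Fin n → Fin n → Prop) [DecidableRel A] : Decidable (InvQ A) := by
  unfold InvQ; infer_instance

theorem InvQ.map {V W : Type} {K : SimpleGraph V} {L : SimpleGraph W} (φ : K ≃g L)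
    (h : InvQ K.Adj) : InvQ L.Adj := by
  obtain ⟨v, hl, a, ha, b, hb, hab, c, hc, hac, hbc, habc⟩ := h
  refine ⟨φ v, ?_, φ a, φ.map_rel_iff'.2 ha, φ b, φ.map_rel_iff'.2 hb, φ.injective.ne hab,
    φ c, φ.map_rel_iff'.2 hc, φ.injective.ne hac, φ.injective.ne hbc, ?_⟩
  swap
  · intro t ht
    obtain ⟨t, rfl⟩ := φ.surjective t
    rcases habc t (φ.map_rel_iff'.1 ht) with h | h | h <;> simp [h]
  intro t ht u hu
  obtain ⟨t, rfl⟩ := φ.surjective t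
  obtain ⟨u, rfl⟩ := φ.surjective u
  rw [hl t (φ.map_rel_iff'.1 ht) u (φ.map_rel_iff'.1 hu)]

/-- Adjacency in `G - e₁ + (y, 5)`. -/
def A7 (y a b : Fin 7) : Prop := a.1 ≠ b.1 ∧ (RX 3 1 5 y.1 5 a.1 b.1 ∨ RX 3 1 5 y.1 5 b.1 a.1)

/-- Adjacency in `G - e₁ + (y, 5) - pq`. -/
def B7 (y p q a b : Fin 7) : Prop :=
  A7 y a b ∧ ¬ ((a.1 = p.1 ∧ b.1 = q.1) ∨ (a.1 = q.1 ∧ b.1 = p.1))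

instance (y : Fin 7) : DecidableRel (A7 y) := fun a b => by unfold A7; infer_instance

instance (y p q : Fin 7) : DecidableRel (B7 y p q) := fun a b => by unfold B7; infer_instance

theorem dec7 : ∀ y : Fin 7, y.1 ≠ 1 → y.1 ≠ 5 → ∀ p q : Fin 7, InvQ (B7 y p q) → A7 y p q →
    (y.1 = 3 ∧ ((p.1 = 2 ∧ q.1 = 3) ∨ (p.1 = 3 ∧ q.1 = 2))) ∨
    (y.1 = 0 ∧ ((p.1 = 1 ∧ q.1 = 2) ∨ (p.1 = 2 ∧ q.1 = 1))) := by
  have : ∀ y : Fin 7, y.1 ≠ 1 → y.1 ≠ 5 → ∀ p q : Fin 7, A7 y p q → InvQ (B7 y p q) →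
    (y.1 = 3 ∧ ((p.1 = 2 ∧ q.1 = 3) ∨ (p.1 = 3 ∧ q.1 = 2))) ∨
    (y.1 = 0 ∧ ((p.1 = 1 ∧ q.1 = 2) ∨ (p.1 = 2 ∧ q.1 = 1))) := by decide +kernel
  exact fun y h1 h2 p q h3 h4 => this y h1 h2 p q h4 h3

theorem invQ_del (y p q : Fin 7) (h : InvQ ((mk 7 (RX 3 1 5 y.1 5)).deleteEdges {s(p, q)}).Adj) :
    InvQ (B7 y p q) := by
  have : ((mk 7 (RX 3 1 5 y.1 5)).deleteEdges {s(p, q)}).Adj = B7 y p q := by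
    funext a b
    exact propext del_adj
  rwa [this] at h

theorem invQ_card12 : InvQ ((GG 3).deleteEdges {ed 7 1 2 (by omega) (by omega)}).Adj := by
  refine ⟨⟨3, by omega⟩, ?_, ⟨2, by omega⟩, ?_, ⟨4, by omega⟩, ?_, by simp, ⟨6, by omega⟩, ?_,
    by simp, by simp, ?_⟩
  · rintro ⟨t, _⟩ ht ⟨u, _⟩ hu
    simp only [GG, ed, del_adj, R, Fin.mk.injEq] at *
    grind
  · simp only [GG, ed, del_adj, R]; grind
  · simp only [GG, ed, del_adj, R]; grind
  · simp only [GG, ed, del_adj, R]; grind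
  rintro ⟨t, _⟩ ht
  simp only [GG, ed, del_adj, R, Fin.mk.injEq] at *
  grind

theorem invQ_card23 : InvQ ((GG 3).deleteEdges {ed 7 2 3 (by omega) (by omega)}).Adj := by
  refine ⟨⟨1, by omega⟩, ?_, ⟨0, by omega⟩, ?_, ⟨2, by omega⟩, ?_, by simp, ⟨5, by omega⟩, ?_,
    by simp, by simp, ?_⟩
  · rintro ⟨t, _⟩ ht ⟨u, _⟩ hu
    simp only [GG, ed, del_adj, R, Fin.mk.injEq] at *
    grind
  · simp only [GG, ed, del_adj, R]; grind
  · simp only [GG, ed, del_adj, R]; grind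
  · simp only [GG, ed, del_adj, R]; grind
  rintro ⟨t, _⟩ ht
  simp only [GG, ed, del_adj, R, Fin.mk.injEq] at *
  grind

theorem upper3 : Good (GG 3)
    {ed 7 1 5 (by omega) (by omega), ed 7 1 2 (by omega) (by omega),
      ed 7 2 3 (by omega) (by omega)} := by
  refine good_of (GG 3) (ed 7 1 5 (by omega) (by omega))
    (ed 7 1 2 (by omega) (by omega)) (ed 7 2 3 (by omega) (by omega))
    (ed_ne (by omega)) (ed_ne (by omega)) (ed_ne (by omega)) _ (by simp) (by simp) (by simp) ?_
  intro H y z f₂ f₃ hyz hf2 hf3 hf23 hmem hmem3 hH h2 h3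
  obtain ⟨w, hw, hs, rfl⟩ := form_H 3 (by omega) 2 (by omega) (by omega) H y z f₃ hyz hH h3
  by_cases hw1 : w.1 = 1
  · rw [hw1]; exact iso_one 3
  exfalso
  obtain ⟨φ⟩ := h2
  obtain ⟨χ⟩ := h3
  induction f₂ using Sym2.ind with
  | _ p q =>
  induction f₃ using Sym2.ind with
  | _ p' q' =>
  have c2 := dec7 w hw1 hw p q (invQ_del w p q (invQ_card12.map φ.symm)) hmem
  have c3 := dec7 w hw1 hw p' q' (invQ_del w p' q' (invQ_card23.map χ.symm)) hmem3
  simp only [ne_eq, Sym2.eq_iff, Fin.ext_iff] at hf23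
  omega

theorem exists_good (m : ℕ) (hm : 3 ≤ m) (hodd : m % 2 = 1) :
    ∃ s : Finset (Sym2 (Fin (m + 4))), s.card = 3 ∧ (↑s : Set (Sym2 (Fin (m + 4)))) ⊆
      (GG m).edgeSet ∧ Good (GG m) s := by
  by_cases h3 : m = 3
  · subst h3
    refine ⟨_, ?_, ?_, upper3⟩
    · rw [Finset.card_eq_three]
      exact ⟨_, _, _, ed_ne (by omega), ed_ne (by omega), ed_ne (by omega), rfl⟩
    · intro e he
      simp only [Finset.coe_insert, Finset.coe_singleton, Set.mem_insert_iff,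
        Set.mem_singleton_iff] at he
      rcases he with rfl | rfl | rfl <;> exact ed_mem (by simp only [R]; grind)
  · refine ⟨_, ?_, ?_, upper5 m (by omega)⟩
    · rw [Finset.card_eq_three]
      exact ⟨_, _, _, ed_ne (by omega), ed_ne (by omega), ed_ne (by omega), rfl⟩
    · intro e he
      simp only [Finset.coe_insert, Finset.coe_singleton, Set.mem_insert_iff,
        Set.mem_singleton_iff] at he
      rcases he with rfl | rfl | rfl <;> exact ed_mem (by simp only [R]; grind)

/-- For every even `d ≥ 4`, the caterpillar `C(2,0,…,0,2)` with spine on `d - 1` vertices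
(hence of diameter `d`) has edge-reconstruction number 3. -/
theorem stmt10 (d : ℕ) (hd : 4 ≤ d) (he : Even d) : ern (doubleBroom (d - 1)) = 3 := by
  have hm : 3 ≤ d - 1 := by omega
  have hodd : (d - 1) % 2 = 1 := by
    obtain ⟨k, hk⟩ := he
    omega
  generalize d - 1 = m at hm hodd
  obtain ⟨ψ⟩ := exists_iso_GG m hm
  rw [ern_congr ψ, ern_eq]
  refine le_antisymm (Nat.sInf_le (exists_good m hm hodd)) ?_
  refine le_csInf ⟨3, exists_good m hm hodd⟩ ?_
  rintro k ⟨s, rfl, hs, hgood⟩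
  by_contra hc
  have he₀ : ed (m + 4) 0 1 (by omega) (by omega) ∈ (GG m).edgeSet :=
    ed_mem (by simp only [R]; grind)
  exact not_good_of_bad (GG m) _ he₀ (bad_all m hm hodd) s hs (by omega) hgood

end ErnPaper
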